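/- Let n, d be positive integers, η > 0, C ∈ ℝ^{n×n}, V, W ∈ ℝ^{n×d}, r, c ∈ ℝⁿ. For all x, y ∈ ℝⁿ and A ∈ ℝ^{n×d}, the infimum of the super-martingale Lagrangian L(P,S,x,y,A) over all entrywise-nonnegative P ∈ ℝ^{n×n} and S ∈ ℝ^{n×d} is attained and equals g(x,y,A), the dual potential of the entropic super-martingale optimal transport problem. -/

import Mathlib

open Matrix

noncomputable section

/-- Entropy function with the convention `0 * log 0 = 0` (note `Real.log 0 = 0`). -/
def ent (x : ℝ) : ℝ := x * Real.log x

/-- The dual potential of the entropic super-martingale optimal transport problem. -/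
def dualG {n d : ℕ} (η : ℝ) (C : Matrix (Fin n) (Fin n) ℝ)
    (V W : Matrix (Fin n) (Fin d) ℝ) (r c : Fin n → ℝ)
    (x y : Fin n → ℝ) (A : Matrix (Fin n) (Fin d) ℝ) : ℝ :=
  -(1 / η) * ∑ i, ∑ j,
      Real.exp (η * (-(C i j) + (∑ k, A i k * V j k) + x i + y j) - 1)
  + ∑ i, x i * r i + ∑ j, y j * c j
  + ∑ i, ∑ k, A i k * W i k
  - (1 / η) * ∑ i, ∑ k, Real.exp (-(η * A i k) - 1)

/-- The Lagrangian of the entropic super-martingale optimal transport problem. -/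
def LagSMOT {n d : ℕ} (η : ℝ) (C : Matrix (Fin n) (Fin n) ℝ)
    (V W : Matrix (Fin n) (Fin d) ℝ) (r c : Fin n → ℝ)
    (P : Matrix (Fin n) (Fin n) ℝ) (S : Matrix (Fin n) (Fin d) ℝ)
    (x y : Fin n → ℝ) (A : Matrix (Fin n) (Fin d) ℝ) : ℝ :=
  (1 / η) * ((∑ i, ∑ j, ent (P i j)) + ∑ i, ∑ k, ent (S i k))
  + (∑ i, ∑ j, C i j * P i j)
  - ∑ i, x i * ((∑ j, P i j) - r i)
  - ∑ j, y j * ((∑ i, P i j) - c j)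
  - ∑ i, ∑ k, A i k * ((P * V) i k - W i k - S i k)

/-- The entropy lies above its tangent line of slope `b`. -/
theorem neg_exp_le_ent_sub (b : ℝ) {p : ℝ} (hp : 0 ≤ p) :
    -Real.exp (b - 1) ≤ ent p - b * p := by
  unfold ent
  rcases hp.eq_or_lt with rfl | hp
  · simp [Real.exp_nonneg]
  · have h : Real.exp (b - 1) = p * Real.exp (b - 1 - Real.log p) := by
      rw [Real.exp_sub _ (Real.log p), Real.exp_log hp]
      field_simp
    have := mul_le_mul_of_nonneg_left (Real.add_one_le_exp (b - 1 - Real.log p)) hp.le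
    rw [h]
    linarith

theorem ent_exp_sub (b : ℝ) :
    ent (Real.exp (b - 1)) - b * Real.exp (b - 1) = -Real.exp (b - 1) := by
  rw [ent, Real.log_exp]
  ring

/-- The Lagrangian separates over the entries of `P` and `S`. -/
theorem lagSMOT_eq_sum {n d : ℕ} {η : ℝ} (hη : η ≠ 0)
    (C : Matrix (Fin n) (Fin n) ℝ) (V W : Matrix (Fin n) (Fin d) ℝ) (r c : Fin n → ℝ)
    (P : Matrix (Fin n) (Fin n) ℝ) (S : Matrix (Fin n) (Fin d) ℝ)
    (x y : Fin n → ℝ) (A : Matrix (Fin n) (Fin d) ℝ) :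
    LagSMOT η C V W r c P S x y A =
      (1 / η) * ((∑ i, ∑ j, (ent (P i j)
          - η * (-(C i j) + (∑ k, A i k * V j k) + x i + y j) * P i j))
        + ∑ i, ∑ k, (ent (S i k) - -(η * A i k) * S i k))
      + ∑ i, x i * r i + ∑ j, y j * c j + ∑ i, ∑ k, A i k * W i k := by
  have hPV : ∑ i, ∑ k, A i k * (P * V) i k
      = ∑ i, ∑ j, (∑ k, A i k * V j k) * P i j := by
    refine Finset.sum_congr rfl fun i _ => ?_
    simp only [Matrix.mul_apply, Finset.mul_sum, Finset.sum_mul]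
    rw [Finset.sum_comm]
    exact Finset.sum_congr rfl fun j _ => Finset.sum_congr rfl fun k _ => by ring
  have hy : ∑ j, y j * ∑ i, P i j = ∑ i, ∑ j, y j * P i j := by
    simp only [Finset.mul_sum]
    exact Finset.sum_comm
  have hP : ∑ i, ∑ j, (ent (P i j)
        - η * (-(C i j) + (∑ k, A i k * V j k) + x i + y j) * P i j)
      = (∑ i, ∑ j, ent (P i j)) - η * (-(∑ i, ∑ j, C i j * P i j)
        + (∑ i, ∑ j, (∑ k, A i k * V j k) * P i j)
        + (∑ i, x i * ∑ j, P i j) + ∑ i, ∑ j, y j * P i j) := by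
    simp only [Finset.sum_sub_distrib, mul_assoc, add_mul, neg_mul, Finset.sum_add_distrib,
      Finset.sum_neg_distrib, ← Finset.mul_sum]
  have hS : ∑ i, ∑ k, (ent (S i k) - -(η * A i k) * S i k)
      = (∑ i, ∑ k, ent (S i k)) + η * ∑ i, ∑ k, A i k * S i k := by
    simp only [neg_mul, sub_neg_eq_add, Finset.sum_add_distrib, mul_assoc, ← Finset.mul_sum]
  rw [hP, hS, LagSMOT]
  simp only [mul_sub, Finset.sum_sub_distrib]
  rw [hPV, hy]
  field_simp
  ring

theorem dualG_eq {n d : ℕ} (η : ℝ)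
    (C : Matrix (Fin n) (Fin n) ℝ) (V W : Matrix (Fin n) (Fin d) ℝ) (r c : Fin n → ℝ)
    (x y : Fin n → ℝ) (A : Matrix (Fin n) (Fin d) ℝ) :
    dualG η C V W r c x y A =
      (1 / η) * ((∑ i, ∑ j,
          -Real.exp (η * (-(C i j) + (∑ k, A i k * V j k) + x i + y j) - 1))
        + ∑ i, ∑ k, -Real.exp (-(η * A i k) - 1))
      + ∑ i, x i * r i + ∑ j, y j * c j + ∑ i, ∑ k, A i k * W i k := by
  simp only [dualG, Finset.sum_neg_distrib]
  ring

theorem stmt14 (n d : ℕ) (hn : 0 < n) (hd : 0 < d)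
    (η : ℝ) (hη : 0 < η)
    (C : Matrix (Fin n) (Fin n) ℝ) (V W : Matrix (Fin n) (Fin d) ℝ)
    (r c : Fin n → ℝ)
    (x y : Fin n → ℝ) (A : Matrix (Fin n) (Fin d) ℝ) :
    IsLeast {z : ℝ | ∃ (P : Matrix (Fin n) (Fin n) ℝ) (S : Matrix (Fin n) (Fin d) ℝ),
        (∀ i j, 0 ≤ P i j) ∧ (∀ i k, 0 ≤ S i k) ∧
        z = LagSMOT η C V W r c P S x y A}
      (dualG η C V W r c x y A) := by
  rw [dualG_eq]
  constructor
  · refine ⟨.of fun i j => Real.exp (η * (-(C i j) + (∑ k, A i k * V j k) + x i + y j) - 1),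
      .of fun i k => Real.exp (-(η * A i k) - 1),
      fun _ _ => Real.exp_nonneg _, fun _ _ => Real.exp_nonneg _, ?_⟩
    rw [lagSMOT_eq_sum hη.ne']
    simp only [Matrix.of_apply, ent_exp_sub]
  · rintro _ ⟨P, S, hP, hS, rfl⟩
    rw [lagSMOT_eq_sum hη.ne']
    gcongr
    · exact neg_exp_le_ent_sub _ (hP _ _)
    · exact neg_exp_le_ent_sub _ (hS _ _)

end
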